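/- (Invariance of the distribution matching distillation gradient.) Let Θ be a real normed vector space, M = Matrix (Fin N) (Fin (3+d)) ℝ, and fix real numbers α, σ and θ₀ ∈ Θ. Let G : Θ → M → M satisfy G θ (z * R̄) = (G θ z) * R̄ for all θ ∈ Θ, z ∈ M, and all block rotations R̄ arising from rotations R ∈ SO(3), and suppose that for every z ∈ M the map θ ↦ G θ z has Fréchet derivative D_z : Θ →L[ℝ] M at θ₀. Let s_real, s_fake : M → M be SO(3)-equivariant maps (s(x * R̄) = s(x) * R̄), let p be the standard Gaussian density on M, and assume that for every x ∈ M the map ε ↦ p(ε) • (s_real(α • x + σ • ε) − s_fake(α • x + σ • ε)) is integrable. Then for every z ∈ M, every rotation R ∈ SO(3) with block rotation R̄, and every direction v ∈ Θ: ∫ p(ε) · ⟨ s_real(α • G θ₀ (z * R̄) + σ • ε) − s_fake(α • G θ₀ (z * R̄) + σ • ε), D_{z*R̄}(v) ⟩_F dε = ∫ p(ε) · ⟨ s_real(α • G θ₀ z + σ • ε) − s_fake(α • G θ₀ z + σ • ε), D_z(v) ⟩_F dε; that is, the directional θ-gradient of the distribution matching loss at an input z is invariant under rotating z. -/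

import Mathlib

open Matrix MeasureTheory

/-- The block rotation `R̄ = fromBlocks R 0 0 1` of size `(3+d) × (3+d)` obtained from a
`3 × 3` rotation `R`, reindexed to `Fin (3+d)`. -/
noncomputable def blockRot (d : ℕ) (R : Matrix (Fin 3) (Fin 3) ℝ) :
    Matrix (Fin (3 + d)) (Fin (3 + d)) ℝ :=
  Matrix.reindex finSumFinEquiv finSumFinEquiv
    (Matrix.fromBlocks R 0 0 (1 : Matrix (Fin d) (Fin d) ℝ))

/-- Lebesgue (volume) measure on `N × m` real matrices. -/
noncomputable instance matrixMeasureSpace (N m : ℕ) :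
    MeasureSpace (Matrix (Fin N) (Fin m) ℝ) :=
  inferInstanceAs (MeasureSpace (Fin N → Fin m → ℝ))

noncomputable instance matrixNormedAddCommGroup (N m : ℕ) :
    NormedAddCommGroup (Matrix (Fin N) (Fin m) ℝ) :=
  inferInstanceAs (NormedAddCommGroup (Fin N → Fin m → ℝ))

noncomputable instance matrixNormedSpace (N m : ℕ) :
    NormedSpace ℝ (Matrix (Fin N) (Fin m) ℝ) :=
  inferInstanceAs (NormedSpace ℝ (Fin N → Fin m → ℝ))

/-- The Frobenius norm of a real `N × m` matrix. -/
noncomputable def frobNorm {N m : ℕ} (A : Matrix (Fin N) (Fin m) ℝ) : ℝ :=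
  Real.sqrt (∑ i, ∑ j, (A i j) ^ 2)

/-- The standard Gaussian density `p(ε) = (2π)^(−N·m/2) · exp(−‖ε‖_F²/2)`. -/
noncomputable def gaussDensity {N m : ℕ} (A : Matrix (Fin N) (Fin m) ℝ) : ℝ :=
  (2 * Real.pi) ^ (-(N * m : ℝ) / 2) * Real.exp (-(frobNorm A) ^ 2 / 2)

/-- The Frobenius inner product `⟨A, B⟩_F = trace (A * Bᵀ)`. -/
noncomputable def frobInner {N m : ℕ} (A B : Matrix (Fin N) (Fin m) ℝ) : ℝ :=
  Matrix.trace (A * Bᵀ)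

theorem blockRot_orth (d : ℕ) (R : Matrix (Fin 3) (Fin 3) ℝ) (hR : R * Rᵀ = 1) :
    blockRot d R * (blockRot d R)ᵀ = 1 := by
  unfold blockRot
  rw [Matrix.reindex_apply, Matrix.transpose_submatrix, Matrix.submatrix_mul_equiv,
    Matrix.fromBlocks_transpose, Matrix.fromBlocks_multiply]
  simp [hR]

theorem frobInner_mul {N m : ℕ} (A B : Matrix (Fin N) (Fin m) ℝ) (Q : Matrix (Fin m) (Fin m) ℝ)
    (hQ : Q * Qᵀ = 1) : frobInner (A * Q) (B * Q) = frobInner A B := by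
  unfold frobInner
  rw [Matrix.transpose_mul, Matrix.mul_assoc, ← Matrix.mul_assoc Q, hQ, Matrix.one_mul]

theorem frobNorm_eq {N m : ℕ} (A : Matrix (Fin N) (Fin m) ℝ) :
    frobNorm A = Real.sqrt (frobInner A A) := by
  unfold frobNorm frobInner
  simp [Matrix.trace, Matrix.mul_apply, pow_two]

theorem gaussDensity_mul {N m : ℕ} (A : Matrix (Fin N) (Fin m) ℝ) (Q : Matrix (Fin m) (Fin m) ℝ)
    (hQ : Q * Qᵀ = 1) : gaussDensity (A * Q) = gaussDensity A := by
  unfold gaussDensity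
  rw [frobNorm_eq, frobNorm_eq, frobInner_mul _ _ _ hQ]

theorem mp_row {m : ℕ} (Q : Matrix (Fin m) (Fin m) ℝ) (hQ : Q * Qᵀ = 1) :
    MeasurePreserving (fun x : Fin m → ℝ => Matrix.vecMul x Q) volume volume := by
  have hd : Q.det * Q.det = 1 := by
    have := congrArg Matrix.det hQ
    simpa using this
  have h0 : Qᵀ.det ≠ 0 := by
    rw [Matrix.det_transpose]; intro h; simp [h] at hd
  have h1 : |Qᵀ.det| = 1 := by
    rw [Matrix.det_transpose]
    rcases mul_self_eq_one_iff.mp hd with h | h <;> simp [h]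
  have e : (fun x : Fin m → ℝ => Matrix.vecMul x Q) = (Matrix.toLin' Qᵀ) := by
    ext x i
    simp [Matrix.mulVec_transpose]
  rw [e]
  refine ⟨(LinearMap.continuous_of_finiteDimensional _).measurable, ?_⟩
  rw [Real.map_matrix_volume_pi_eq_smul_volume_pi h0, abs_inv, h1]
  simp

theorem mp_mat {N m : ℕ} (Q : Matrix (Fin m) (Fin m) ℝ) (hQ : Q * Qᵀ = 1) :
    MeasurePreserving (fun x : Matrix (Fin N) (Fin m) ℝ => x * Q) volume volume :=
  volume_preserving_pi (fun _ : Fin N => mp_row Q hQ)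

theorem integral_mul_right_eq {N m : ℕ} (Q : Matrix (Fin m) (Fin m) ℝ) (hQ : Q * Qᵀ = 1)
    (f : Matrix (Fin N) (Fin m) ℝ → ℝ) : ∫ x : Matrix (Fin N) (Fin m) ℝ, f (x * Q) = ∫ x, f x := by
  have hQ' : Qᵀ * Q = 1 := mul_eq_one_comm.mp hQ
  let e : Matrix (Fin N) (Fin m) ℝ ≃ᵐ Matrix (Fin N) (Fin m) ℝ :=
    { toFun := fun x => x * Q
      invFun := fun x => x * Qᵀ
      left_inv := fun x => by simp [Matrix.mul_assoc, hQ]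
      right_inv := fun x => by simp [Matrix.mul_assoc, hQ']
      measurable_toFun := (mp_mat Q hQ).measurable
      measurable_invFun := (mp_mat Qᵀ (by simpa using hQ')).measurable }
  have he : MeasurePreserving e volume volume := mp_mat Q hQ
  exact he.integral_comp' f

theorem deriv_mul_aux {N m : ℕ} {Θ : Type*} [NormedAddCommGroup Θ] [NormedSpace ℝ Θ] (θ₀ : Θ)
    (g h : Θ → Matrix (Fin N) (Fin m) ℝ) (Q : Matrix (Fin m) (Fin m) ℝ)
    (D E : Θ →L[ℝ] Matrix (Fin N) (Fin m) ℝ) (hg : HasFDerivAt g D θ₀) (hh : HasFDerivAt h E θ₀)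
    (hgh : ∀ θ, h θ = g θ * Q) (v : Θ) : E v = D v * Q := by
  haveI : FiniteDimensional ℝ (Matrix (Fin N) (Fin m) ℝ) :=
    inferInstanceAs (FiniteDimensional ℝ (Fin N → Fin m → ℝ))
  let L : Matrix (Fin N) (Fin m) ℝ →ₗ[ℝ] Matrix (Fin N) (Fin m) ℝ :=
    { toFun := fun x => x * Q
      map_add' := fun x y => Matrix.add_mul x y Q
      map_smul' := fun c x => Matrix.smul_mul c x Q }
  have h2 := (LinearMap.toContinuousLinearMap L).hasFDerivAt.comp θ₀ hg
  have e : h = (LinearMap.toContinuousLinearMap L) ∘ g := funext hgh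
  rw [← e] at h2
  rw [hh.unique h2]
  rfl

/-- **Invariance of the distribution matching distillation gradient.**
Let `G : Θ → M → M` be equivariant at every parameter (`G θ (z * R̄) = (G θ z) * R̄` for
all block rotations `R̄` of rotations `R ∈ SO(3)`), with `θ ↦ G θ z` having Fréchet
derivative `D z` at `θ₀` for every `z`; let `s_real, s_fake : M → M` be SO(3)-equivariant,
and let `p` be the standard Gaussian density, with the score-difference integrand
integrable at every `x`.  Then the directional θ-gradient of the distribution matching
loss is invariant under rotating the input `z`. -/
theorem dmd_gradient_invariant (N d : ℕ) (Θ : Type*) [NormedAddCommGroup Θ]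
    [NormedSpace ℝ Θ] (α σ : ℝ) (θ₀ : Θ)
    (G : Θ → Matrix (Fin N) (Fin (3 + d)) ℝ → Matrix (Fin N) (Fin (3 + d)) ℝ)
    (hG : ∀ (θ : Θ) (z : Matrix (Fin N) (Fin (3 + d)) ℝ) (R : Matrix (Fin 3) (Fin 3) ℝ),
      R * Rᵀ = 1 → R.det = 1 → G θ (z * blockRot d R) = G θ z * blockRot d R)
    (D : Matrix (Fin N) (Fin (3 + d)) ℝ → (Θ →L[ℝ] Matrix (Fin N) (Fin (3 + d)) ℝ))
    (hD : ∀ z, HasFDerivAt (fun θ => G θ z) (D z) θ₀)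
    (sreal sfake : Matrix (Fin N) (Fin (3 + d)) ℝ → Matrix (Fin N) (Fin (3 + d)) ℝ)
    (hsreal : ∀ (z : Matrix (Fin N) (Fin (3 + d)) ℝ) (R : Matrix (Fin 3) (Fin 3) ℝ),
      R * Rᵀ = 1 → R.det = 1 → sreal (z * blockRot d R) = sreal z * blockRot d R)
    (hsfake : ∀ (z : Matrix (Fin N) (Fin (3 + d)) ℝ) (R : Matrix (Fin 3) (Fin 3) ℝ),
      R * Rᵀ = 1 → R.det = 1 → sfake (z * blockRot d R) = sfake z * blockRot d R)
    (hint : ∀ x : Matrix (Fin N) (Fin (3 + d)) ℝ,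
      Integrable (fun ε =>
        gaussDensity ε • (sreal (α • x + σ • ε) - sfake (α • x + σ • ε))) volume)
    (z : Matrix (Fin N) (Fin (3 + d)) ℝ) (R : Matrix (Fin 3) (Fin 3) ℝ)
    (hR : R * Rᵀ = 1) (hdet : R.det = 1) (v : Θ) :
    ∫ ε, gaussDensity ε *
        frobInner (sreal (α • G θ₀ (z * blockRot d R) + σ • ε) -
            sfake (α • G θ₀ (z * blockRot d R) + σ • ε))
          (D (z * blockRot d R) v) =
      ∫ ε, gaussDensity ε *
        frobInner (sreal (α • G θ₀ z + σ • ε) - sfake (α • G θ₀ z + σ • ε)) (D z v) := by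
  have hQ := blockRot_orth d R hR
  rw [deriv_mul_aux θ₀ _ _ (blockRot d R) _ _ (hD z) (hD (z * blockRot d R))
    (fun θ => hG θ z R hR hdet) v, ← integral_mul_right_eq (blockRot d R) hQ]
  congr 1
  funext ε
  rw [gaussDensity_mul _ _ hQ, hG θ₀ z R hR hdet, ← Matrix.smul_mul, ← Matrix.smul_mul,
    ← Matrix.add_mul, hsreal _ R hR hdet, hsfake _ R hR hdet, ← Matrix.sub_mul,
    frobInner_mul _ _ _ hQ]
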